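/- Let n ≥ 1, s, t ∈ ℝ and 1 ≤ p, q ≤ ∞. Then there exists a constant C ≥ 1 such that C^{−1} ‖f‖_{W^s_{p,q}} ≤ ‖(I − Δ)^{t/2} f‖_{W^{s−t}_{p,q}} ≤ C ‖f‖_{W^s_{p,q}} for all f ∈ 𝒮(ℝⁿ), where (I − Δ)^{t/2} f = ℱ^{−1}[ξ ↦ ⟨ξ⟩^t f̂(ξ)] is the Bessel potential of order t, which maps 𝒮(ℝⁿ) to 𝒮(ℝⁿ). -/

import Mathlib

open MeasureTheory Real
open scoped ENNReal RealInnerProductSpace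

noncomputable section

/-- The short-time Fourier transform
`V_g f (x, ξ) = ∫ e^{-i ξ·t} conj (g (t - x)) f t dt`. -/
def STFT {n : ℕ} (g f : EuclideanSpace ℝ (Fin n) → ℂ)
    (x ξ : EuclideanSpace ℝ (Fin n)) : ℂ :=
  ∫ t : EuclideanSpace ℝ (Fin n),
    Complex.exp (-(Complex.I * Complex.ofReal ⟪ξ, t⟫)) * (starRingEnd ℂ) (g (t - x)) * f t

/-- The Fourier transform `f̂ (ξ) = ∫ e^{-i ξ·x} f x dx`. -/
def FT {n : ℕ} (f : EuclideanSpace ℝ (Fin n) → ℂ) (ξ : EuclideanSpace ℝ (Fin n)) : ℂ :=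
  ∫ x : EuclideanSpace ℝ (Fin n),
    Complex.exp (-(Complex.I * Complex.ofReal ⟪ξ, x⟫)) * f x

/-- The power of the Japanese bracket `⟨x⟩ˢ = (1 + |x|²)^(s/2)`. -/
def jp {n : ℕ} (s : ℝ) (x : EuclideanSpace ℝ (Fin n)) : ℝ := (1 + ‖x‖ ^ 2) ^ (s / 2)

/-- The Gaussian window `g₀ (t) = e^{-|t|²}`. -/
def gauss {n : ℕ} (t : EuclideanSpace ℝ (Fin n)) : ℂ := Complex.ofReal (Real.exp (-‖t‖ ^ 2))

/-- The `L^p` norm (valued in `ℝ≥0∞`) of an `ℝ≥0∞`-valued function. -/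
def lpN {n : ℕ} (p : ℝ≥0∞) (F : EuclideanSpace ℝ (Fin n) → ℝ≥0∞) : ℝ≥0∞ :=
  if p = ∞ then essSup F volume
  else (∫⁻ x, F x ^ p.toReal) ^ p.toReal⁻¹

/-- The Wiener amalgam space norm `‖f‖_{W^s_{p,q}}`:
inner `L^q` norm in the frequency variable ξ, outer `L^p` norm in the space variable x,
with the Gaussian window. -/
def WNorm {n : ℕ} (s : ℝ) (p q : ℝ≥0∞) (f : EuclideanSpace ℝ (Fin n) → ℂ) : ℝ≥0∞ :=
  lpN p (fun x => lpN q (fun ξ => ENNReal.ofReal (jp s ξ) * (‖STFT gauss f x ξ‖₊ : ℝ≥0∞)))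

/-- The modulation space norm `‖f‖_{M^s_{p,q}}`:
inner `L^p` norm in the space variable x, outer `L^q` norm in the frequency variable ξ,
with the Gaussian window. -/
def MNorm {n : ℕ} (s : ℝ) (p q : ℝ≥0∞) (f : EuclideanSpace ℝ (Fin n) → ℂ) : ℝ≥0∞ :=
  lpN q (fun ξ => lpN p (fun x => ENNReal.ofReal (jp s ξ) * (‖STFT gauss f x ξ‖₊ : ℝ≥0∞)))

/-- The Schrödinger operator `e^{iεΔ} f = ℱ⁻¹ [ξ ↦ e^{-iε|ξ|²} f̂ (ξ)]` (`ε = ±1`). -/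
def schrod {n : ℕ} (ε : ℝ) (f : EuclideanSpace ℝ (Fin n) → ℂ)
    (x : EuclideanSpace ℝ (Fin n)) : ℂ :=
  (((2 * Real.pi) ^ n)⁻¹ : ℝ) *
    ∫ ξ : EuclideanSpace ℝ (Fin n),
      Complex.exp (Complex.I * Complex.ofReal ⟪x, ξ⟫) *
        Complex.exp (-(Complex.ofReal ε * Complex.I * Complex.ofReal (‖ξ‖ ^ 2))) * FT f ξ

/-- The lattice point `k ∈ ℤⁿ` viewed as a point of `ℝⁿ`. -/
def zlift {n : ℕ} (k : Fin n → ℤ) : EuclideanSpace ℝ (Fin n) :=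
  (WithLp.equiv 2 (Fin n → ℝ)).symm fun i => (k i : ℝ)


/-- The Bessel potential `(I - Δ)^{t/2} f = ℱ⁻¹ [ξ ↦ ⟨ξ⟩ᵗ f̂ (ξ)]`. -/
def bessel {n : ℕ} (t : ℝ) (f : EuclideanSpace ℝ (Fin n) → ℂ)
    (x : EuclideanSpace ℝ (Fin n)) : ℂ :=
  (((2 * Real.pi) ^ n)⁻¹ : ℝ) *
    ∫ ξ : EuclideanSpace ℝ (Fin n),
      Complex.exp (Complex.I * Complex.ofReal ⟪x, ξ⟫) * Complex.ofReal (jp t ξ) * FT f ξ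

/-- The function `x ↦ ‖H x ·‖_{L^q}` is measurable when `H` is jointly measurable. -/
theorem measurable_eLpNorm_right {α β : Type*} [MeasurableSpace α] [MeasurableSpace β]
    {ν : Measure β} [SFinite ν] {q : ℝ≥0∞} (hq : q ≠ 0) {H : α → β → ℝ≥0∞}
    (hH : Measurable (Function.uncurry H)) : Measurable fun a => eLpNorm (H a) q ν := by
  by_cases hq' : q = ∞
  · subst hq'
    refine measurable_of_Iic fun c => ?_
    have hS : MeasurableSet {x : α × β | c < H x.1 x.2} := measurableSet_lt measurable_const hH
    have h : (fun a => eLpNorm (H a) ∞ ν) ⁻¹' Set.Iic c =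
        (fun a => ν (Prod.mk a ⁻¹' {x : α × β | c < H x.1 x.2})) ⁻¹' {0} := by
      ext a
      simp only [Set.mem_preimage, Set.mem_Iic, Set.mem_singleton_iff, eLpNorm_exponent_top]
      constructor
      · intro h
        have h2 : ∀ᵐ b ∂ν, H a b ≤ c := by
          filter_upwards [enorm_ae_le_eLpNormEssSup (H a) ν] with b hb
          exact hb.trans h
        rw [ae_iff] at h2
        simpa using h2
      · intro h
        refine eLpNormEssSup_le_of_ae_enorm_bound ?_
        rw [ae_iff]
        simpa using h
    rw [h]
    exact measurable_measure_prodMk_left hS (measurableSet_singleton 0)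
  · simp_rw [eLpNorm_eq_lintegral_rpow_enorm_toReal hq hq', enorm_eq_self]
    exact ((hH.pow_const _).lintegral_prod_right').pow_const _

/-- Jensen's inequality for powers, with a weight `a`. -/
theorem lintegral_rpow_le_mul_lintegral_rpow {α : Type*} [MeasurableSpace α] {μ : Measure α}
    {r : ℝ} (hr : 1 ≤ r) {a h : α → ℝ≥0∞} (ha : Measurable a) (hh : Measurable h) :
    (∫⁻ z, a z * h z ∂μ) ^ r ≤ (∫⁻ z, a z ∂μ) ^ (r - 1) * ∫⁻ z, a z * h z ^ r ∂μ := by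
  have h0 : 0 < r := by linarith
  have key := eLpNorm'_le_eLpNorm'_mul_rpow_measure_univ (μ := μ.withDensity a) (f := h)
    one_pos hr hh.aestronglyMeasurable
  simp only [eLpNorm', enorm_eq_self, ENNReal.rpow_one, div_one] at key
  rw [lintegral_withDensity_eq_lintegral_mul _ ha hh,
    lintegral_withDensity_eq_lintegral_mul _ ha (hh.pow_const r),
    withDensity_apply _ MeasurableSet.univ, Measure.restrict_univ] at key
  have key2 := ENNReal.rpow_le_rpow key h0.le
  rw [ENNReal.mul_rpow_of_nonneg _ _ h0.le, ← ENNReal.rpow_mul, ← ENNReal.rpow_mul,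
    one_div_mul_cancel h0.ne', ENNReal.rpow_one, sub_mul, one_div_mul_cancel h0.ne', one_mul,
    mul_comm a, mul_comm _ (_ ^ (r - 1))] at key2
  simpa [mul_comm] using key2

/-- Minkowski's integral inequality. -/
theorem eLpNorm_lintegral_le {α β : Type*} [MeasurableSpace α] [MeasurableSpace β]
    {μ : Measure α} [IsFiniteMeasure μ] {ν : Measure β} [SFinite ν] {q : ℝ≥0∞} (hq : 1 ≤ q)
    {H : α → β → ℝ≥0∞} (hH : Measurable (Function.uncurry H)) :
    eLpNorm (fun b => ∫⁻ z, H z b ∂μ) q ν ≤ ∫⁻ z, eLpNorm (H z) q ν ∂μ := by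
  have hq0 : q ≠ 0 := (zero_lt_one.trans_le hq).ne'
  have hN : Measurable fun z => eLpNorm (H z) q ν := measurable_eLpNorm_right hq0 hH
  by_cases hq' : q = ∞
  · subst hq'
    rw [eLpNorm_exponent_top]
    refine eLpNormEssSup_le_of_ae_enorm_bound ?_
    have h1 : ∀ᵐ z ∂μ, ∀ᵐ b ∂ν, H z b ≤ eLpNorm (H z) ∞ ν := by
      refine Filter.Eventually.of_forall fun z => ?_
      rw [eLpNorm_exponent_top]
      exact enorm_ae_le_eLpNormEssSup (H z) ν
    rw [Measure.ae_ae_comm (p := fun z b => H z b ≤ eLpNorm (H z) ∞ ν)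
      (measurableSet_le hH (hN.comp measurable_fst))] at h1
    filter_upwards [h1] with b hb
    exact lintegral_mono_ae hb
  set r := q.toReal with hr
  have hr1 : 1 ≤ r := by
    have := ENNReal.toReal_mono hq' hq
    simpa using this
  have hr0 : 0 < r := by linarith
  set N : α → ℝ≥0∞ := fun z => eLpNorm (H z) q ν with hNdef
  have hNr : ∀ z, ∫⁻ b, H z b ^ r ∂ν = N z ^ r := by
    intro z
    simp only [hNdef]
    rw [eLpNorm_eq_lintegral_rpow_enorm_toReal hq0 hq', ← ENNReal.rpow_mul,
      one_div_mul_cancel hr0.ne', ENNReal.rpow_one]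
    simp [hr]
  have hlim : ∀ ε : NNReal, 0 < ε → eLpNorm (fun b => ∫⁻ z, H z b ∂μ) q ν ≤
      ∫⁻ z, N z ∂μ + ε * μ Set.univ := by
    intro ε hε
    by_cases hM : ∫⁻ z, N z ∂μ = ∞
    · simp [hM]
    have hfin : ∀ᵐ z ∂μ, N z < ∞ := ae_lt_top hN hM
    set a : α → ℝ≥0∞ := fun z => N z + ε with ha
    have hma : Measurable a := hN.add_const _
    have ha0 : ∀ z, a z ≠ 0 := fun z => by simp [ha, hε.ne']
    have hmH : Measurable fun x : α × β => H x.1 x.2 / a x.1 :=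
      Measurable.div hH (hma.comp measurable_fst)
    have hA : ∫⁻ z, a z ∂μ = ∫⁻ z, N z ∂μ + ε * μ Set.univ := by
      simp only [ha]
      rw [lintegral_add_right _ measurable_const, lintegral_const]
    have hpt : ∀ b, (∫⁻ z, H z b ∂μ) ^ r ≤
        (∫⁻ z, a z ∂μ) ^ (r - 1) * ∫⁻ z, a z * (H z b / a z) ^ r ∂μ := by
      intro b
      have e : ∫⁻ z, H z b ∂μ = ∫⁻ z, a z * (H z b / a z) ∂μ := by
        refine lintegral_congr_ae ?_
        filter_upwards [hfin] with z hz
        rw [ENNReal.mul_div_cancel (ha0 z) (by simp [ha, hz.ne])]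
      rw [e]
      exact lintegral_rpow_le_mul_lintegral_rpow hr1 hma
        (hmH.comp (measurable_id.prodMk measurable_const))
    have hone : ∀ᵐ z ∂μ, ∫⁻ b, (a z * (H z b / a z) ^ r) ∂ν ≤ a z := by
      filter_upwards [hfin] with z hz
      have hat : a z ≠ ∞ := by simp [ha, hz.ne]
      have hm1 : Measurable fun b => H z b := hH.comp (measurable_const.prodMk measurable_id)
      rw [lintegral_const_mul _ ((hm1.div_const _).pow_const r)]
      refine mul_le_of_le_one_right' ?_
      simp_rw [div_eq_mul_inv, ENNReal.mul_rpow_of_nonneg _ _ hr0.le]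
      rw [lintegral_mul_const _ (hm1.pow_const r),
        hNr, ← ENNReal.mul_rpow_of_nonneg _ _ hr0.le]
      refine ENNReal.rpow_le_one ?_ hr0.le
      rw [← div_eq_mul_inv]
      refine ENNReal.div_le_of_le_mul ?_
      simp [ha]
    have hmain : ∫⁻ b, (∫⁻ z, H z b ∂μ) ^ r ∂ν ≤ (∫⁻ z, a z ∂μ) ^ r := by
      calc ∫⁻ b, (∫⁻ z, H z b ∂μ) ^ r ∂ν
          ≤ ∫⁻ b, (∫⁻ z, a z ∂μ) ^ (r - 1) * ∫⁻ z, a z * (H z b / a z) ^ r ∂μ ∂ν :=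
            lintegral_mono hpt
        _ = (∫⁻ z, a z ∂μ) ^ (r - 1) * ∫⁻ b, ∫⁻ z, a z * (H z b / a z) ^ r ∂μ ∂ν := by
            refine lintegral_const_mul _ ?_
            exact ((hma.comp measurable_fst).mul (hmH.pow_const r)).lintegral_prod_left'
        _ = (∫⁻ z, a z ∂μ) ^ (r - 1) * ∫⁻ z, ∫⁻ b, a z * (H z b / a z) ^ r ∂ν ∂μ := by
            rw [lintegral_lintegral_swap]
            exact (((hma.comp measurable_fst).mul (hmH.pow_const r)).comp
              measurable_swap).aemeasurable
        _ ≤ (∫⁻ z, a z ∂μ) ^ (r - 1) * ∫⁻ z, a z ∂μ := by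
            gcongr 1
            exact lintegral_mono_ae hone
        _ = (∫⁻ z, a z ∂μ) ^ r := by
            nth_rewrite 2 [← ENNReal.rpow_one (∫⁻ z, a z ∂μ)]
            rw [← ENNReal.rpow_add_of_nonneg _ _ (by linarith) zero_le_one, sub_add_cancel]
    rw [eLpNorm_eq_lintegral_rpow_enorm_toReal hq0 hq', ← hA]
    simp only [enorm_eq_self]
    calc _ ≤ ((∫⁻ z, a z ∂μ) ^ r) ^ (1 / r) := ENNReal.rpow_le_rpow hmain (by positivity)
      _ = _ := by rw [← ENNReal.rpow_mul, mul_one_div_cancel hr0.ne', ENNReal.rpow_one]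
  refine ENNReal.le_of_forall_pos_le_add fun ε hε _ => ?_
  have hμ : μ Set.univ ≠ ∞ := measure_ne_top μ _
  refine (hlim (ε / ((μ Set.univ).toNNReal + 1)) (by positivity)).trans ?_
  gcongr
  rw [← ENNReal.coe_toNNReal hμ, ← ENNReal.coe_mul, ENNReal.coe_le_coe, div_mul_eq_mul_div]
  refine div_le_of_le_mul₀ (by positivity) (by positivity) ?_
  rw [ENNReal.toNNReal_coe]
  gcongr
  simp

section JapaneseBracket

variable {n : ℕ}

theorem jp_pos (r : ℝ) (x : EuclideanSpace ℝ (Fin n)) : 0 < jp r x := by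
  unfold jp; positivity

theorem jp_mono {r r' : ℝ} (h : r ≤ r') (x : EuclideanSpace ℝ (Fin n)) : jp r x ≤ jp r' x := by
  unfold jp
  exact rpow_le_rpow_of_exponent_le (by nlinarith [sq_nonneg ‖x‖]) (by linarith)

theorem jp_mul_jp (r r' : ℝ) (x : EuclideanSpace ℝ (Fin n)) :
    jp r x * jp r' x = jp (r + r') x := by
  unfold jp
  rw [← rpow_add (by positivity), add_div]

theorem jp_zero (x : EuclideanSpace ℝ (Fin n)) : jp 0 x = 1 := by simp [jp]

theorem jp_neg_arg (r : ℝ) (x : EuclideanSpace ℝ (Fin n)) : jp r (-x) = jp r x := by simp [jp]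

theorem jp_sub_comm (r : ℝ) (x y : EuclideanSpace ℝ (Fin n)) : jp r (x - y) = jp r (y - x) := by
  rw [← jp_neg_arg, neg_sub]

theorem continuous_jp (r : ℝ) : Continuous (jp r : EuclideanSpace ℝ (Fin n) → ℝ) := by
  unfold jp
  exact (by fun_prop : Continuous fun x : EuclideanSpace ℝ (Fin n) => 1 + ‖x‖ ^ 2).rpow_const
    fun x => Or.inl (by positivity)

theorem integrable_jp {r : ℝ} (hr : r < -n) :
    Integrable (jp r : EuclideanSpace ℝ (Fin n) → ℝ) := by
  have := integrable_rpow_neg_one_add_norm_sq (E := EuclideanSpace ℝ (Fin n)) (μ := volume)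
    (r := -r) (by simp; linarith)
  have e : (jp r : EuclideanSpace ℝ (Fin n) → ℝ) = fun x => (1 + ‖x‖ ^ 2) ^ (r / 2) := rfl
  rw [e]
  simpa using this

theorem norm_le_jp_one (x : EuclideanSpace ℝ (Fin n)) : ‖x‖ ≤ jp 1 x := by
  unfold jp
  rw [← sqrt_eq_rpow]
  exact le_sqrt_of_sq_le (by linarith)

theorem norm_le_norm_two_pi_smul (x : EuclideanSpace ℝ (Fin n)) : ‖x‖ ≤ ‖(2 * π) • x‖ := by
  rw [norm_smul, norm_of_nonneg (by positivity)]
  nlinarith [norm_nonneg x, pi_gt_three]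

/-- **Peetre's inequality**. -/
theorem jp_le_peetre (t : ℝ) (u v : EuclideanSpace ℝ (Fin n)) :
    jp t u ≤ 2 ^ (|t| / 2) * jp t v * jp |t| (u - v) := by
  have base : ∀ u v : EuclideanSpace ℝ (Fin n),
      1 + ‖u‖ ^ 2 ≤ 2 * (1 + ‖v‖ ^ 2) * (1 + ‖u - v‖ ^ 2) := by
    intro u v
    have h : ‖u‖ ≤ ‖v‖ + ‖u - v‖ := by simpa using norm_add_le v (u - v)
    nlinarith [norm_nonneg u, norm_nonneg v, norm_nonneg (u - v), sq_nonneg (‖v‖ - ‖u - v‖),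
      mul_nonneg (sq_nonneg ‖v‖) (sq_nonneg ‖u - v‖)]
  have main : ∀ u v : EuclideanSpace ℝ (Fin n),
      jp |t| u ≤ 2 ^ (|t| / 2) * jp |t| v * jp |t| (u - v) := by
    intro u v
    unfold jp
    rw [← mul_rpow (by norm_num) (by positivity), ← mul_rpow (by positivity) (by positivity)]
    exact rpow_le_rpow (by positivity) (base u v) (by positivity)
  rcases le_total 0 t with h | h
  · simpa [abs_of_nonneg h] using main u v
  · have hm := main v u
    rw [jp_sub_comm] at hm
    have e : ∀ x : EuclideanSpace ℝ (Fin n), jp |t| x * jp t x = 1 := fun x => by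
      rw [jp_mul_jp, abs_of_nonpos h, neg_add_cancel, jp_zero]
    calc jp t u = jp |t| v * (jp t u * jp t v) := by
          rw [mul_left_comm, e, mul_one]
      _ ≤ 2 ^ (|t| / 2) * jp |t| u * jp |t| (u - v) * (jp t u * jp t v) := by
          gcongr
          exact (mul_pos (jp_pos _ _) (jp_pos _ _)).le
      _ = 2 ^ (|t| / 2) * jp t v * jp |t| (u - v) * (jp |t| u * jp t u) := by ring
      _ = _ := by rw [e, mul_one]

/-- Gaussians decay faster than any power of the Japanese bracket. -/
theorem exp_neg_le_jp (r : ℝ) : ∃ C : ℝ, ∀ u : EuclideanSpace ℝ (Fin n),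
    rexp (-(‖u‖ ^ 2 / 4)) ≤ C * jp r u := by
  set a := |r| / 2 + 1 with ha
  have ha1 : 1 ≤ a := by have := abs_nonneg r; linarith
  refine ⟨(4 * a) ^ a, fun u => ?_⟩
  set v := ‖u‖ ^ 2 with hv
  have hv0 : 0 ≤ v := by positivity
  have h1 : 1 + v ≤ 4 * a * rexp (v / (4 * a)) := by
    have h := add_one_le_exp (v / (4 * a))
    calc 1 + v ≤ 4 * a * (v / (4 * a) + 1) := by
          rw [mul_add, mul_div_cancel₀ _ (by positivity)]; linarith
      _ ≤ _ := by gcongr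
  have h2 : (1 + v) ^ (-(r / 2)) ≤ (4 * a) ^ a * rexp (v / 4) := by
    calc (1 + v) ^ (-(r / 2)) ≤ (1 + v) ^ a :=
          rpow_le_rpow_of_exponent_le (by linarith) (by have := neg_abs_le r; linarith)
      _ ≤ (4 * a * rexp (v / (4 * a))) ^ a := rpow_le_rpow (by positivity) h1 (by positivity)
      _ = _ := by
          rw [mul_rpow (by positivity) (by positivity), ← exp_mul]
          congr 2
          field_simp
  unfold jp
  rw [← hv]
  have h3 : (1 + v) ^ (-(r / 2)) * (1 + v) ^ (r / 2) = 1 := by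
    rw [← rpow_add (by positivity), neg_add_cancel, rpow_zero]
  calc rexp (-(v / 4)) = rexp (-(v / 4)) * ((1 + v) ^ (-(r / 2)) * (1 + v) ^ (r / 2)) := by
        rw [h3, mul_one]
    _ ≤ rexp (-(v / 4)) * (((4 * a) ^ a * rexp (v / 4)) * (1 + v) ^ (r / 2)) := by gcongr
    _ = (4 * a) ^ a * (1 + v) ^ (r / 2) * (rexp (-(v / 4)) * rexp (v / 4)) := by ring
    _ = _ := by rw [← exp_add, neg_add_cancel, exp_zero, mul_one]

end JapaneseBracket

section SymbolBounds

variable {n : ℕ}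

theorem norm_iteratedFDeriv_clm_le {F : Type*} [NormedAddCommGroup F] [NormedSpace ℝ F]
    (T : EuclideanSpace ℝ (Fin n) →L[ℝ] F) (k : ℕ) (x : EuclideanSpace ℝ (Fin n)) :
    ‖iteratedFDeriv ℝ k T x‖ ≤ ‖T‖ * jp 1 ((2 * π) • x) := by
  have h1 : 1 ≤ jp 1 ((2 * π) • x) :=
    (jp_zero ((2 * π) • x)).symm.trans_le (jp_mono zero_le_one _)
  match k with
  | 0 =>
    rw [norm_iteratedFDeriv_zero]
    refine (T.le_opNorm x).trans ?_
    gcongr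
    exact (norm_le_norm_two_pi_smul x).trans (norm_le_jp_one _)
  | 1 =>
    rw [← norm_iteratedFDeriv_fderiv, norm_iteratedFDeriv_zero, ContinuousLinearMap.fderiv]
    exact le_mul_of_one_le_right (norm_nonneg _) h1
  | k + 2 =>
    have h : fderiv ℝ (T : EuclideanSpace ℝ (Fin n) → F) = fun _ => T := by
      ext1 y; exact ContinuousLinearMap.fderiv T
    rw [← norm_iteratedFDeriv_fderiv, h, iteratedFDeriv_const_of_ne (Nat.succ_ne_zero k)]
    simp only [Pi.zero_apply, norm_zero]
    positivity

theorem norm_iteratedFDeriv_le_jp {g : ℝ → EuclideanSpace ℝ (Fin n) → ℝ} {c : ℝ → ℝ}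
    (hg : ∀ r, ContDiff ℝ ((⊤ : ℕ∞) : WithTop ℕ∞) (g r))
    (hd : ∀ r x, fderiv ℝ (g r) x = (c r * g (r - 2) x) • innerSL ℝ x)
    (hb : ∀ r, ∃ C, ∀ x, |g r x| ≤ C * jp r ((2 * π) • x)) (k : ℕ) :
    ∀ r, ∃ C, ∀ x, ‖iteratedFDeriv ℝ k (g r) x‖ ≤ C * jp r ((2 * π) • x) := by
  induction k using Nat.strong_induction_on with
  | _ k ih =>
  intro r
  match k with
  | 0 => simpa [norm_iteratedFDeriv_zero] using hb r
  | k + 1 =>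
    have ih' : ∀ i, ∃ C, i ≤ k → ∀ x,
        ‖iteratedFDeriv ℝ i (g (r - 2)) x‖ ≤ C * jp (r - 2) ((2 * π) • x) := by
      intro i
      by_cases hi : i ≤ k
      · obtain ⟨C, hC⟩ := ih i (by omega) (r - 2)
        exact ⟨C, fun _ => hC⟩
      · exact ⟨0, fun h => absurd h hi⟩
    choose C hC using ih'
    set T : EuclideanSpace ℝ (Fin n) →L[ℝ] EuclideanSpace ℝ (Fin n) →L[ℝ] ℝ :=
      c r • innerSL ℝ with hT
    have hfd : fderiv ℝ (g r) = fun x => g (r - 2) x • T x := by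
      ext1 x
      rw [hd, hT, _root_.smul_apply, smul_smul, mul_comm]
    refine ⟨∑ i ∈ Finset.range (k + 1), (k.choose i : ℝ) * C i * ‖T‖, fun x => ?_⟩
    rw [← norm_iteratedFDeriv_fderiv, hfd]
    refine (norm_iteratedFDeriv_smul_le (hg (r - 2)) T.contDiff x
      (mod_cast le_top : (k : WithTop ℕ∞) ≤ ((⊤ : ℕ∞) : WithTop ℕ∞))).trans ?_
    rw [Finset.sum_mul]
    refine Finset.sum_le_sum fun i hi => ?_
    have h1 := hC i (by simpa [Nat.lt_succ_iff] using hi) x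
    have hC0 : 0 ≤ C i := nonneg_of_mul_nonneg_left ((norm_nonneg _).trans h1) (jp_pos _ _)
    have h2 := norm_iteratedFDeriv_clm_le T (k - i) x
    calc (k.choose i : ℝ) * ‖iteratedFDeriv ℝ i (g (r - 2)) x‖ * ‖iteratedFDeriv ℝ (k - i) T x‖
        ≤ (k.choose i : ℝ) * (C i * jp (r - 2) ((2 * π) • x)) * (‖T‖ * jp 1 ((2 * π) • x)) := by
          gcongr
          exact mul_nonneg (Nat.cast_nonneg _) (mul_nonneg hC0 (jp_pos _ _).le)
      _ = (k.choose i : ℝ) * C i * ‖T‖ * (jp (r - 2) ((2 * π) • x) * jp 1 ((2 * π) • x)) := by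
          ring
      _ ≤ _ := by
          rw [jp_mul_jp]
          gcongr
          exact jp_mono (by linarith) _

/-- The Fourier transform, up to a constant, of the Gaussian window. -/
def dualGauss (η : EuclideanSpace ℝ (Fin n)) : ℝ := rexp (-(π ^ 2 * ‖η‖ ^ 2))

theorem contDiff_dualGauss {m : WithTop ℕ∞} :
    ContDiff ℝ m (dualGauss : EuclideanSpace ℝ (Fin n) → ℝ) := by
  unfold dualGauss
  exact (contDiff_const.mul (contDiff_norm_sq ℝ)).neg.exp

theorem norm_iteratedFDeriv_dualGauss_le (k : ℕ) (r : ℝ) :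
    ∃ C, ∀ x : EuclideanSpace ℝ (Fin n),
      ‖iteratedFDeriv ℝ k dualGauss x‖ ≤ C * jp r ((2 * π) • x) := by
  refine norm_iteratedFDeriv_le_jp (g := fun _ => dualGauss) (c := fun _ => -(2 * π ^ 2))
    (fun _ => contDiff_dualGauss) (fun _ x => ?_) (fun r => ?_) k r
  · have h := (((hasStrictFDerivAt_norm_sq x).hasFDerivAt.const_mul (π ^ 2)).neg.exp).fderiv
    change fderiv ℝ (fun y : EuclideanSpace ℝ (Fin n) => rexp (-(π ^ 2 * ‖y‖ ^ 2))) x = _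
    refine h.trans ?_
    ext y
    simp [dualGauss]
    ring
  · obtain ⟨C, hC⟩ := exp_neg_le_jp (n := n) r
    refine ⟨C, fun x => ?_⟩
    have := hC ((2 * π) • x)
    rw [dualGauss, abs_of_pos (exp_pos _)]
    convert this using 2
    rw [norm_smul, norm_of_nonneg (by positivity)]
    ring

theorem contDiff_jp {m : WithTop ℕ∞} (r : ℝ) :
    ContDiff ℝ m fun x : EuclideanSpace ℝ (Fin n) => jp r ((2 * π) • x) := by
  unfold jp
  refine contDiff_iff_contDiffAt.2 fun x => ContDiffAt.rpow_const_of_ne ?_ (by positivity)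
  exact (contDiff_const.add ((contDiff_norm_sq ℝ).comp (contDiff_const_smul _))).contDiffAt

theorem norm_iteratedFDeriv_jp_le (k : ℕ) (r : ℝ) :
    ∃ C, ∀ x : EuclideanSpace ℝ (Fin n),
      ‖iteratedFDeriv ℝ k (fun x => jp r ((2 * π) • x)) x‖ ≤ C * jp r ((2 * π) • x) := by
  refine norm_iteratedFDeriv_le_jp (g := fun r x => jp r ((2 * π) • x))
    (c := fun r => r * (2 * π) ^ 2) (fun r => contDiff_jp r) (fun r x => ?_)
    (fun r => ⟨1, fun x => by rw [one_mul, abs_of_pos (jp_pos _ _)]⟩) k r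
  have e : (fun y : EuclideanSpace ℝ (Fin n) => jp r ((2 * π) • y)) =
      fun y => (1 + (2 * π) ^ 2 * ‖y‖ ^ 2) ^ (r / 2) := by
    ext y
    rw [jp, norm_smul, norm_of_nonneg (by positivity), mul_pow]
  have h := ((((hasStrictFDerivAt_norm_sq x).hasFDerivAt.const_mul ((2 * π) ^ 2)).const_add
    1).rpow_const (p := r / 2) (Or.inl (by positivity))).fderiv
  rw [e, h, jp, norm_smul, norm_of_nonneg (by positivity), mul_pow, sub_div,
    div_self two_ne_zero]
  ext y
  simp
  ring_nf

/-- A family of smooth functions all of whose derivatives are dominated by the weights `W i`,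
uniformly in the parameter `i`. -/
def DerivBound {ι : Type*} (a : ι → EuclideanSpace ℝ (Fin n) → ℂ)
    (W : ι → EuclideanSpace ℝ (Fin n) → ℝ) : Prop :=
  (∀ i, ContDiff ℝ ((⊤ : ℕ∞) : WithTop ℕ∞) (a i)) ∧
    ∀ k, ∃ C, ∀ i x, ‖iteratedFDeriv ℝ k (a i) x‖ ≤ C * W i x

theorem DerivBound.mul {ι : Type*} {a b : ι → EuclideanSpace ℝ (Fin n) → ℂ}
    {V W : ι → EuclideanSpace ℝ (Fin n) → ℝ} (ha : DerivBound a V) (hb : DerivBound b W) :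
    DerivBound (fun i x => a i x * b i x) (fun i x => V i x * W i x) := by
  refine ⟨fun i => (ha.1 i).mul (hb.1 i), fun k => ?_⟩
  choose A hA using ha.2
  choose B hB using hb.2
  refine ⟨∑ j ∈ Finset.range (k + 1), (k.choose j : ℝ) * (A j * B (k - j)), fun i x => ?_⟩
  refine (norm_iteratedFDeriv_mul_le (ha.1 i) (hb.1 i) x
    (mod_cast le_top : (k : WithTop ℕ∞) ≤ ((⊤ : ℕ∞) : WithTop ℕ∞))).trans ?_
  rw [Finset.sum_mul]
  refine Finset.sum_le_sum fun j _ => ?_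
  calc (k.choose j : ℝ) * ‖iteratedFDeriv ℝ j (a i) x‖ * ‖iteratedFDeriv ℝ (k - j) (b i) x‖
      ≤ (k.choose j : ℝ) * (A j * V i x) * (B (k - j) * W i x) := by
        have := (norm_nonneg _).trans (hA j i x)
        gcongr
        · exact hA j i x
        · exact hB (k - j) i x
    _ = _ := by ring

theorem norm_iteratedFDeriv_ofReal (g : EuclideanSpace ℝ (Fin n) → ℝ)
    (hg : ContDiff ℝ ((⊤ : ℕ∞) : WithTop ℕ∞) g) (k : ℕ) (x : EuclideanSpace ℝ (Fin n)) :
    ‖iteratedFDeriv ℝ k (fun y => (g y : ℂ)) x‖ = ‖iteratedFDeriv ℝ k g x‖ :=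
  Complex.ofRealLI.norm_iteratedFDeriv_comp_left hg.contDiffAt
    (mod_cast le_top : (k : WithTop ℕ∞) ≤ ((⊤ : ℕ∞) : WithTop ℕ∞))

theorem derivBound_jp {ι : Type*} (r : ℝ) :
    DerivBound (fun (_ : ι) (x : EuclideanSpace ℝ (Fin n)) => (jp r ((2 * π) • x) : ℂ))
      (fun _ x => jp r ((2 * π) • x)) := by
  refine ⟨fun _ => Complex.ofRealCLM.contDiff.comp (contDiff_jp r), fun k => ?_⟩
  obtain ⟨C, hC⟩ := norm_iteratedFDeriv_jp_le (n := n) k r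
  exact ⟨C, fun _ x => (norm_iteratedFDeriv_ofReal _ (contDiff_jp r) k x).trans_le (hC x)⟩

theorem derivBound_dualGauss {ι : Type*} (r : ℝ) (c : ι → EuclideanSpace ℝ (Fin n)) :
    DerivBound (fun i x => (dualGauss (x - (2 * π)⁻¹ • c i) : ℂ))
      (fun i x => jp r ((2 * π) • x - c i)) := by
  refine ⟨fun i => Complex.ofRealCLM.contDiff.comp
    (contDiff_dualGauss.comp (contDiff_id.sub contDiff_const)), fun k => ?_⟩
  obtain ⟨C, hC⟩ := norm_iteratedFDeriv_dualGauss_le (n := n) k r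
  refine ⟨C, fun i x => ?_⟩
  rw [iteratedFDeriv_comp_sub (f := fun y => (dualGauss y : ℂ)),
    norm_iteratedFDeriv_ofReal _ contDiff_dualGauss]
  refine (hC _).trans_eq ?_
  rw [smul_sub, smul_smul, mul_inv_cancel₀ (by positivity), one_smul]

end SymbolBounds

section KernelBound

open FourierTransform

variable {n : ℕ}

theorem integrable_jp_two_pi_smul_sub {r : ℝ} (hr : r < -n) (c : EuclideanSpace ℝ (Fin n)) :
    Integrable fun x => jp r ((2 * π) • x - c) := by
  have h := ((integrable_jp hr).comp_smul (R := 2 * π) (by positivity)).comp_sub_right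
    ((2 * π)⁻¹ • c)
  simpa only [smul_sub, smul_smul, mul_inv_cancel₀ two_pi_pos.ne', one_smul] using h

theorem integral_jp_two_pi_smul_sub (r : ℝ) (c : EuclideanSpace ℝ (Fin n)) :
    ∫ x, jp r ((2 * π) • x - c) = ∫ x : EuclideanSpace ℝ (Fin n), jp r ((2 * π) • x) := by
  rw [← integral_sub_right_eq_self (fun x : EuclideanSpace ℝ (Fin n) => jp r ((2 * π) • x))
    ((2 * π)⁻¹ • c)]
  simp only [smul_sub, smul_smul, mul_inv_cancel₀ two_pi_pos.ne', one_smul]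

theorem integrable_iteratedFDeriv_of_le {f : EuclideanSpace ℝ (Fin n) → ℂ}
    (hf : ContDiff ℝ ((⊤ : ℕ∞) : WithTop ℕ∞) f) {k : ℕ} {g : EuclideanSpace ℝ (Fin n) → ℝ}
    (hg : Integrable g) (h : ∀ x, ‖iteratedFDeriv ℝ k f x‖ ≤ g x) :
    Integrable fun x => ‖iteratedFDeriv ℝ k f x‖ := by
  refine hg.mono' ?_ (Filter.Eventually.of_forall fun x => by simpa using h x)
  exact (hf.continuous_iteratedFDeriv (m := k) (mod_cast le_top)).norm.aestronglyMeasurable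

theorem jp_mul_norm_fourier_le {f : EuclideanSpace ℝ (Fin n) → ℂ}
    (hf : ContDiff ℝ ((⊤ : ℕ∞) : WithTop ℕ∞) f)
    (hi : ∀ k, Integrable fun x => ‖iteratedFDeriv ℝ k f x‖) (M : ℕ)
    (w : EuclideanSpace ℝ (Fin n)) :
    jp (2 * M) w * ‖𝓕 f w‖ ≤ 2 ^ M * 2 ^ (2 * M) *
      ((∫ x, ‖iteratedFDeriv ℝ 0 f x‖) +
        ∑ k ∈ Finset.range (2 * M + 1), ∫ x, ‖iteratedFDeriv ℝ k f x‖) := by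
  have key : ∀ N : ℕ, ‖w‖ ^ N * ‖𝓕 f w‖ ≤
      2 ^ N * ∑ k ∈ Finset.range (N + 1), ∫ x, ‖iteratedFDeriv ℝ k f x‖ := by
    intro N
    have h := pow_mul_norm_iteratedFDeriv_fourier_le (K := 0) (N := ⊤) hf
      (fun k m hk _ => by
        have : k = 0 := by simpa using hk
        simpa [this] using hi m) (k := 0) (n := N) (by simp) le_top w
    rw [Finset.sum_product] at h
    simpa [norm_iteratedFDeriv_zero] using h
  have hM : jp (2 * M) w ≤ 2 ^ M * (1 + ‖w‖ ^ (2 * M)) := by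
    rw [jp, mul_div_cancel_left₀ _ two_ne_zero, rpow_natCast]
    refine (add_pow_le zero_le_one (sq_nonneg _) M).trans ?_
    rw [one_pow, ← pow_mul]
    gcongr
    · norm_num
    · omega
  have h0 := key 0
  have h1 := key (2 * M)
  simp only [pow_zero, one_mul, zero_add, Finset.sum_range_one] at h0
  have hS : (0 : ℝ) ≤ ∫ x, ‖iteratedFDeriv ℝ 0 f x‖ := integral_nonneg fun _ => norm_nonneg _
  calc jp (2 * M) w * ‖𝓕 f w‖ ≤ 2 ^ M * (1 + ‖w‖ ^ (2 * M)) * ‖𝓕 f w‖ := by gcongr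
    _ = 2 ^ M * (‖𝓕 f w‖ + ‖w‖ ^ (2 * M) * ‖𝓕 f w‖) := by ring
    _ ≤ 2 ^ M * (2 ^ (2 * M) * (∫ x, ‖iteratedFDeriv ℝ 0 f x‖) + 2 ^ (2 * M) *
        ∑ k ∈ Finset.range (2 * M + 1), ∫ x, ‖iteratedFDeriv ℝ k f x‖) := by
        gcongr
        exact h0.trans (le_mul_of_one_le_left hS (one_le_pow₀ one_le_two))
    _ = _ := by ring

/-- Uniform decay of the Fourier transforms of a family of localized symbols. -/
theorem DerivBound.exists_norm_fourier_le {ι : Type*} {a : ι → EuclideanSpace ℝ (Fin n) → ℂ}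
    {W : ι → EuclideanSpace ℝ (Fin n) → ℝ} (ha : DerivBound a W) {r : ℝ} (hr : r < -n)
    {A : ι → ℝ} {c : ι → EuclideanSpace ℝ (Fin n)} (hW0 : ∀ i x, 0 ≤ W i x)
    (hW : ∀ i x, W i x ≤ A i * jp r ((2 * π) • x - c i)) (M : ℕ) :
    (∀ i, Integrable (a i)) ∧
      ∃ C, 0 ≤ C ∧ ∀ i w, ‖𝓕 (a i) w‖ ≤ C * A i * jp (-(2 * M)) w := by
  choose B hB using ha.2
  have hB' : ∀ k i x, ‖iteratedFDeriv ℝ k (a i) x‖ ≤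
      |B k| * (A i * jp r ((2 * π) • x - c i)) := fun k i x =>
    (hB k i x).trans (mul_le_mul (le_abs_self _) (hW i x) (hW0 i x) (abs_nonneg _))
  have hint : ∀ k i, Integrable fun x => |B k| * (A i * jp r ((2 * π) • x - c i)) := fun k i =>
    ((integrable_jp_two_pi_smul_sub hr _).const_mul _).const_mul _
  have hi : ∀ k i, Integrable fun x => ‖iteratedFDeriv ℝ k (a i) x‖ := fun k i =>
    integrable_iteratedFDeriv_of_le (ha.1 i) (hint k i) (hB' k i)
  set J := ∫ x : EuclideanSpace ℝ (Fin n), jp r ((2 * π) • x) with hJ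
  have hJ0 : 0 ≤ J := integral_nonneg fun _ => (jp_pos _ _).le
  have hle : ∀ k i, ∫ x, ‖iteratedFDeriv ℝ k (a i) x‖ ≤ |B k| * J * A i := fun k i =>
    (integral_mono (hi k i) (hint k i) (hB' k i)).trans_eq (by
      rw [integral_const_mul, integral_const_mul, integral_jp_two_pi_smul_sub]; ring)
  refine ⟨fun i => ?_, 2 ^ M * 2 ^ (2 * M) * (|B 0| * J + ∑ k ∈ Finset.range (2 * M + 1), |B k| * J),
    by positivity, fun i w => ?_⟩
  · refine (integrable_norm_iff (ha.1 i).continuous.aestronglyMeasurable).1 ?_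
    simpa only [norm_iteratedFDeriv_zero] using hi 0 i
  have h := jp_mul_norm_fourier_le (ha.1 i) (fun k => hi k i) M w
  have h2 : jp (2 * M) w * ‖𝓕 (a i) w‖ ≤ 2 ^ M * 2 ^ (2 * M) *
      (|B 0| * J + ∑ k ∈ Finset.range (2 * M + 1), |B k| * J) * A i := by
    refine h.trans ?_
    rw [mul_assoc _ _ (A i), add_mul, Finset.sum_mul]
    gcongr
    · exact hle 0 i
    · exact hle _ i
  calc ‖𝓕 (a i) w‖ = jp (2 * M) w * ‖𝓕 (a i) w‖ * jp (-(2 * M)) w := by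
        rw [mul_right_comm, jp_mul_jp, add_neg_cancel, jp_zero, one_mul]
    _ ≤ _ := by
        gcongr
        exact (jp_pos _ _).le

/-- The symbol `⟨·⟩ᵗ` localized by two Gaussians. -/
def localSymbol (t : ℝ) (ξ ζ η : EuclideanSpace ℝ (Fin n)) : ℂ :=
  (dualGauss (η - (2 * π)⁻¹ • ξ) : ℂ) *
    ((jp t ((2 * π) • η) : ℂ) * (dualGauss (η - (2 * π)⁻¹ • ζ) : ℂ))

theorem integrable_localSymbol_and_norm_fourier_le (t : ℝ) {K : ℝ} (hK : 0 ≤ K) :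
    (∀ ξ ζ : EuclideanSpace ℝ (Fin n), Integrable (localSymbol t ξ ζ)) ∧
      ∃ C, 0 ≤ C ∧ ∀ ξ ζ w : EuclideanSpace ℝ (Fin n), ‖𝓕 (localSymbol t ξ ζ) w‖ ≤
        C * (jp t ξ * jp (-K) (ξ - ζ) * jp (-(n + 1)) w) := by
  set N := |t| + K + (n + 1) with hN
  have hD := (derivBound_dualGauss (ι := EuclideanSpace ℝ (Fin n) × EuclideanSpace ℝ (Fin n))
    (-N) Prod.fst).mul ((derivBound_jp t).mul (derivBound_dualGauss (-N) Prod.snd))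
  obtain ⟨hI, C, hC0, hC⟩ := hD.exists_norm_fourier_le (r := -(n + 1)) (by linarith) (c := Prod.fst)
    (A := fun i => 2 ^ (|t| / 2) * 2 ^ (K / 2) * (jp t i.1 * jp (-K) (i.1 - i.2)))
    (fun i x => (mul_pos (jp_pos _ _) (mul_pos (jp_pos _ _) (jp_pos _ _))).le)
    (fun ⟨ξ, ζ⟩ x => by
      dsimp only
      set u := (2 * π) • x
      have h1 := jp_le_peetre t u ξ
      have h2 := jp_le_peetre (-K) (u - ζ) (ξ - ζ)
      rw [sub_sub_sub_cancel_right, abs_neg, abs_of_nonneg hK] at h2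
      have h3 : jp (-N) (u - ζ) ≤ jp (-K) (u - ζ) :=
        jp_mono (by have := abs_nonneg t; have : (0 : ℝ) ≤ n := n.cast_nonneg; linarith) _
      have e : jp (-N) (u - ξ) * (jp |t| (u - ξ) * jp K (u - ξ)) = jp (-(n + 1)) (u - ξ) := by
        rw [jp_mul_jp, jp_mul_jp, hN]; congr 1; ring
      have p := jp_pos (-N) (u - ξ)
      have p' := jp_pos (-N) (u - ζ)
      have p2 := jp_pos t ξ
      have p3 := jp_pos |t| (u - ξ)
      calc jp (-N) (u - ξ) * (jp t u * jp (-N) (u - ζ))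
          ≤ jp (-N) (u - ξ) * ((2 ^ (|t| / 2) * jp t ξ * jp |t| (u - ξ)) *
            (2 ^ (K / 2) * jp (-K) (ξ - ζ) * jp K (u - ξ))) := by
            gcongr
            exact h3.trans h2
        _ = 2 ^ (|t| / 2) * 2 ^ (K / 2) * (jp t ξ * jp (-K) (ξ - ζ)) *
            (jp (-N) (u - ξ) * (jp |t| (u - ξ) * jp K (u - ξ))) := by ring
        _ = _ := by rw [e]) (n + 1)
  refine ⟨fun ξ ζ => hI (ξ, ζ), C * (2 ^ (|t| / 2) * 2 ^ (K / 2)), by positivity, fun ξ ζ w => ?_⟩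
  have p2 := jp_pos t ξ
  have p3 := jp_pos (-K) (ξ - ζ)
  calc ‖𝓕 (localSymbol t ξ ζ) w‖ ≤ _ := hC (ξ, ζ) w
    _ ≤ C * (2 ^ (|t| / 2) * 2 ^ (K / 2) * (jp t ξ * jp (-K) (ξ - ζ))) * jp (-(n + 1)) w := by
        gcongr
        refine jp_mono ?_ w
        push_cast
        have : (0 : ℝ) ≤ n := n.cast_nonneg
        linarith
    _ = _ := by ring

end KernelBound

section Fourier

open FourierTransform SchwartzMap

variable {n : ℕ}

theorem hasTemperateGrowth_jp (t : ℝ) :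
    (fun η : EuclideanSpace ℝ (Fin n) => (jp t ((2 * π) • η) : ℂ)).HasTemperateGrowth := by
  have h1 := Function.hasTemperateGrowth_one_add_norm_sq_rpow (EuclideanSpace ℝ (Fin n)) (t / 2)
  have h2 := ((2 * π) • ContinuousLinearMap.id ℝ (EuclideanSpace ℝ (Fin n))).hasTemperateGrowth
  exact Function.HasTemperateGrowth.comp Complex.ofRealCLM.hasTemperateGrowth
    (Function.HasTemperateGrowth.comp h1 h2)

theorem hasTemperateGrowth_dualGauss (c : EuclideanSpace ℝ (Fin n)) :
    (fun η : EuclideanSpace ℝ (Fin n) =>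
      (dualGauss (η - (2 * π)⁻¹ • c) : ℂ)).HasTemperateGrowth := by
  have h := derivBound_dualGauss 0 fun _ : Unit => c
  refine ⟨h.1 (), fun k => ?_⟩
  obtain ⟨C, hC⟩ := h.2 k
  exact ⟨0, C, fun x => (hC () x).trans_eq (by simp only [jp_zero, pow_zero])⟩

/-- The Fourier multiplier with symbol `m`, in the normalization `⟨x, η⟩ ↦ e^{-2πi⟨x, η⟩}`. -/
def multiplier (m : EuclideanSpace ℝ (Fin n) → ℂ) (f : SchwartzMap (EuclideanSpace ℝ (Fin n)) ℂ) :
    SchwartzMap (EuclideanSpace ℝ (Fin n)) ℂ :=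
  𝓕⁻ (smulLeftCLM ℂ m (𝓕 f))

theorem fourier_multiplier_apply {m : EuclideanSpace ℝ (Fin n) → ℂ} (hm : m.HasTemperateGrowth)
    (f : SchwartzMap (EuclideanSpace ℝ (Fin n)) ℂ) (η : EuclideanSpace ℝ (Fin n)) :
    𝓕 (multiplier m f) η = m η * 𝓕 f η := by
  rw [multiplier, FourierTransform.fourier_fourierInv_eq, smulLeftCLM_apply_apply hm, smul_eq_mul]

theorem multiplier_apply {m : EuclideanSpace ℝ (Fin n) → ℂ} (hm : m.HasTemperateGrowth)
    (f : SchwartzMap (EuclideanSpace ℝ (Fin n)) ℂ) (x : EuclideanSpace ℝ (Fin n)) :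
    multiplier m f x = ∫ η, Complex.exp (2 * π * ⟪η, x⟫ * Complex.I) * (m η * 𝓕 f η) := by
  rw [multiplier, fourierInv_coe, fourierInv_eq']
  simp [smulLeftCLM_apply_apply hm]

/-- The Bessel potential of order `t` as an operator on Schwartz functions. -/
def schwartzBessel (t : ℝ) (f : SchwartzMap (EuclideanSpace ℝ (Fin n)) ℂ) :
    SchwartzMap (EuclideanSpace ℝ (Fin n)) ℂ :=
  multiplier (fun η => (jp t ((2 * π) • η) : ℂ)) f

theorem FT_eq_fourier (f : SchwartzMap (EuclideanSpace ℝ (Fin n)) ℂ)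
    (ξ : EuclideanSpace ℝ (Fin n)) : FT f ξ = 𝓕 f ((2 * π)⁻¹ • ξ) := by
  rw [fourier_coe, fourier_eq', FT]
  refine integral_congr_ae (Filter.Eventually.of_forall fun x => ?_)
  simp only [smul_eq_mul, inner_smul_right, real_inner_comm ξ x]
  congr 2
  push_cast
  have : (π : ℂ) ≠ 0 := mod_cast pi_pos.ne'
  field_simp

theorem bessel_eq_schwartzBessel (t : ℝ) (f : SchwartzMap (EuclideanSpace ℝ (Fin n)) ℂ) :
    bessel t f = schwartzBessel t f := by
  ext x
  rw [schwartzBessel, multiplier_apply (hasTemperateGrowth_jp t), bessel]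
  have h := Measure.integral_comp_inv_smul_of_nonneg (volume : Measure (EuclideanSpace ℝ (Fin n)))
    (fun η => Complex.exp (2 * π * ⟪η, x⟫ * Complex.I) * ((jp t ((2 * π) • η) : ℂ) * 𝓕 f η))
    two_pi_pos.le
  simp only [finrank_euclideanSpace, Fintype.card_fin] at h
  have e : ∀ ξ : EuclideanSpace ℝ (Fin n),
      Complex.exp (Complex.I * (⟪x, ξ⟫ : ℝ)) * (jp t ξ : ℂ) * FT f ξ =
      Complex.exp (2 * π * ⟪(2 * π)⁻¹ • ξ, x⟫ * Complex.I) *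
        ((jp t ((2 * π) • (2 * π)⁻¹ • ξ) : ℂ) * 𝓕 f ((2 * π)⁻¹ • ξ)) := by
    intro ξ
    rw [FT_eq_fourier, smul_smul, mul_inv_cancel₀ two_pi_pos.ne', one_smul, mul_assoc,
      inner_smul_left, real_inner_comm]
    congr 2
    have : (π : ℂ) ≠ 0 := mod_cast pi_pos.ne'
    simp
    field_simp
  simp_rw [e]
  rw [h, Complex.real_smul, ← mul_assoc, ← Complex.ofReal_mul, inv_mul_cancel₀ (by positivity),
    Complex.ofReal_one, one_mul]

theorem schwartzBessel_neg_schwartzBessel (t : ℝ) (f : SchwartzMap (EuclideanSpace ℝ (Fin n)) ℂ) :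
    schwartzBessel (-t) (schwartzBessel t f) = f := by
  have h : 𝓕 (schwartzBessel (-t) (schwartzBessel t f)) = 𝓕 f := by
    ext η
    rw [schwartzBessel, fourier_multiplier_apply (hasTemperateGrowth_jp _), schwartzBessel,
      fourier_multiplier_apply (hasTemperateGrowth_jp _), ← mul_assoc, ← Complex.ofReal_mul,
      jp_mul_jp, neg_add_cancel, jp_zero, Complex.ofReal_one, one_mul]
  have h' := congrArg
    (fun g : SchwartzMap (EuclideanSpace ℝ (Fin n)) ℂ =>
      (𝓕⁻ g : SchwartzMap (EuclideanSpace ℝ (Fin n)) ℂ)) h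
  simpa only [FourierTransform.fourierInv_fourier_eq] using h'

theorem fourier_modulation (h : EuclideanSpace ℝ (Fin n) → ℂ) (x y : EuclideanSpace ℝ (Fin n)) :
    𝓕 (fun η => Complex.exp (2 * π * ⟪η, x⟫ * Complex.I) * h η) y = 𝓕 h (y - x) := by
  rw [fourier_eq', fourier_eq']
  refine integral_congr_ae (Filter.Eventually.of_forall fun η => ?_)
  simp only [smul_eq_mul]
  rw [← mul_assoc, ← Complex.exp_add, inner_sub_right]
  congr 2
  push_cast
  ring

theorem fourier_translation (h : EuclideanSpace ℝ (Fin n) → ℂ) (c y : EuclideanSpace ℝ (Fin n)) :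
    𝓕 (fun η => h (η - c)) y = Complex.exp (-(2 * π * ⟪c, y⟫ * Complex.I)) * 𝓕 h y := by
  rw [fourier_eq', fourier_eq', ← integral_const_mul,
    ← integral_sub_right_eq_self (fun v => Complex.exp (-(2 * π * ⟪c, y⟫ * Complex.I)) *
      (Complex.exp ((-2 * π * ⟪v, y⟫ : ℝ) * Complex.I) • h v)) c]
  refine integral_congr_ae (Filter.Eventually.of_forall fun η => ?_)
  simp only [smul_eq_mul]
  rw [← mul_assoc, ← Complex.exp_add, inner_sub_left]
  congr 2
  push_cast
  ring

theorem integral_fourier_mul_eq_of_integrable {f g : EuclideanSpace ℝ (Fin n) → ℂ}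
    (hf : Integrable f) (hg : Integrable g) : ∫ ξ, 𝓕 f ξ * g ξ = ∫ x, f x * 𝓕 g x := by
  simpa using! VectorFourier.integral_bilin_fourierIntegral_eq_flip (.mul ℂ ℂ)
    (L := innerₗ (EuclideanSpace ℝ (Fin n))) continuous_fourierChar continuous_inner hf hg

theorem integrable_dualGauss : Integrable (dualGauss : EuclideanSpace ℝ (Fin n) → ℝ) := by
  obtain ⟨C, hC⟩ := norm_iteratedFDeriv_dualGauss_le (n := n) 0 (-(n + 1))
  have h := (integrable_jp_two_pi_smul_sub (n := n) (r := -(n + 1)) (by linarith) 0).const_mul C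
  refine h.mono' (contDiff_dualGauss (m := 0)).continuous.aestronglyMeasurable
    (Filter.Eventually.of_forall fun x => ?_)
  simpa using hC x

/-- The normalization constant `∫ e^{-π²|η|²} dη`. -/
def gaussConst (n : ℕ) : ℂ := (π / (π ^ 2 : ℝ)) ^ (n / 2 : ℂ)

theorem gaussConst_ne_zero (n : ℕ) : gaussConst n ≠ 0 := by
  have : (π : ℂ) ≠ 0 := mod_cast pi_pos.ne'
  rw [gaussConst, Complex.cpow_def_of_ne_zero (by simp [this])]
  exact Complex.exp_ne_zero _

theorem fourier_dualGauss (y : EuclideanSpace ℝ (Fin n)) :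
    𝓕 (fun η : EuclideanSpace ℝ (Fin n) => (dualGauss η : ℂ)) y = gaussConst n * gauss y := by
  have h := fourier_gaussian_innerProductSpace (V := EuclideanSpace ℝ (Fin n))
    (b := ((π ^ 2 : ℝ) : ℂ)) (by rw [Complex.ofReal_re]; positivity) y
  have : (π : ℂ) ≠ 0 := mod_cast pi_pos.ne'
  convert h using 2
  · ext η
    simp [dualGauss]
  · simp [gaussConst]
  · simp [gauss]
    field_simp

/-- The short-time Fourier transform with Gaussian window as a Fourier multiplier. -/
theorem multiplier_dualGauss_apply (f : SchwartzMap (EuclideanSpace ℝ (Fin n)) ℂ)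
    (x ξ : EuclideanSpace ℝ (Fin n)) :
    multiplier (fun η => (dualGauss (η - (2 * π)⁻¹ • ξ) : ℂ)) f x =
      gaussConst n * Complex.exp (Complex.I * (⟪ξ, x⟫ : ℝ)) * STFT gauss f x ξ := by
  rw [multiplier_apply (hasTemperateGrowth_dualGauss ξ)]
  have hint : Integrable fun η : EuclideanSpace ℝ (Fin n) =>
      Complex.exp (2 * π * ⟪η, x⟫ * Complex.I) * (dualGauss (η - (2 * π)⁻¹ • ξ) : ℂ) := by
    refine ((integrable_dualGauss (n := n)).comp_sub_right ((2 * π)⁻¹ • ξ)).ofReal.bdd_mul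
      (c := 1) (Continuous.aestronglyMeasurable (by fun_prop))
      (Filter.Eventually.of_forall fun η => ?_)
    rw [← Complex.ofReal_ofNat, ← Complex.ofReal_mul, ← Complex.ofReal_mul,
      Complex.norm_exp_ofReal_mul_I]
  simp_rw [← mul_assoc]
  rw [fourier_coe, ← integral_fourier_mul_eq_of_integrable hint f.integrable, STFT,
    ← integral_const_mul]
  refine integral_congr_ae (Filter.Eventually.of_forall fun y => ?_)
  simp only
  rw [fourier_modulation, fourier_translation (fun η => (dualGauss η : ℂ)), fourier_dualGauss]
  have e : Complex.exp (-(2 * π * ⟪(2 * π)⁻¹ • ξ, y - x⟫ * Complex.I)) =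
      Complex.exp (Complex.I * (⟪ξ, x⟫ : ℝ)) * Complex.exp (-(Complex.I * (⟪ξ, y⟫ : ℝ))) := by
    rw [← Complex.exp_add, inner_smul_left, inner_sub_right]
    congr 1
    have : (π : ℂ) ≠ 0 := mod_cast pi_pos.ne'
    simp
    field_simp
    ring
  rw [e]
  simp only [gauss, Complex.conj_ofReal]
  ring

end Fourier

section Reproducing

open FourierTransform SchwartzMap

variable {n : ℕ}

theorem dualGauss_pos (η : EuclideanSpace ℝ (Fin n)) : 0 < dualGauss η := exp_pos _

theorem dualGauss_le_one (η : EuclideanSpace ℝ (Fin n)) : dualGauss η ≤ 1 :=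
  exp_le_one_iff.2 (neg_nonpos.2 (by positivity))

theorem continuous_dualGauss : Continuous (dualGauss : EuclideanSpace ℝ (Fin n) → ℝ) :=
  (contDiff_dualGauss (m := 0)).continuous

theorem dualGauss_sub_smul (η ζ : EuclideanSpace ℝ (Fin n)) :
    dualGauss (η - (2 * π)⁻¹ • ζ) = dualGauss ((2 * π)⁻¹ • (ζ - (2 * π) • η)) := by
  rw [smul_sub, smul_smul, inv_mul_cancel₀ two_pi_pos.ne', one_smul, dualGauss, dualGauss,
    norm_sub_rev]

theorem integrable_dualGauss_sq :
    Integrable fun ζ : EuclideanSpace ℝ (Fin n) => dualGauss ((2 * π)⁻¹ • ζ) ^ 2 := by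
  refine ((integrable_dualGauss (n := n)).comp_smul (R := (2 * π)⁻¹) (by positivity)).mono'
    (Continuous.aestronglyMeasurable ?_) (Filter.Eventually.of_forall fun ζ => ?_)
  · exact (continuous_dualGauss.comp (continuous_const_smul _)).pow 2
  · rw [norm_pow, norm_of_nonneg (dualGauss_pos _).le]
    exact pow_le_of_le_one (dualGauss_pos _).le (dualGauss_le_one _) two_ne_zero

theorem integrable_dualGauss_sub_smul_sq (η : EuclideanSpace ℝ (Fin n)) :
    Integrable fun ζ : EuclideanSpace ℝ (Fin n) => dualGauss (η - (2 * π)⁻¹ • ζ) ^ 2 := by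
  simp_rw [dualGauss_sub_smul]
  exact integrable_dualGauss_sq.comp_sub_right _

/-- The constant of the reproducing formula. -/
def reproConst (n : ℕ) : ℝ := ∫ ζ : EuclideanSpace ℝ (Fin n), dualGauss ((2 * π)⁻¹ • ζ) ^ 2

theorem integral_dualGauss_sub_smul_sq (η : EuclideanSpace ℝ (Fin n)) :
    ∫ ζ : EuclideanSpace ℝ (Fin n), dualGauss (η - (2 * π)⁻¹ • ζ) ^ 2 = reproConst n := by
  simp_rw [dualGauss_sub_smul]
  exact integral_sub_right_eq_self
    (fun ζ : EuclideanSpace ℝ (Fin n) => dualGauss ((2 * π)⁻¹ • ζ) ^ 2) _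

theorem reproConst_pos (n : ℕ) : 0 < reproConst n := by
  refine (integral_pos_iff_support_of_nonneg (fun ζ => sq_nonneg _) integrable_dualGauss_sq).2 ?_
  have : (Function.support fun ζ : EuclideanSpace ℝ (Fin n) =>
      dualGauss ((2 * π)⁻¹ • ζ) ^ 2) = Set.univ := by
    ext ζ
    simpa using (dualGauss_pos _).ne'
  rw [this]
  exact Measure.measure_univ_pos.2 (NeZero.ne _)

theorem continuous_cexp_inner (x : EuclideanSpace ℝ (Fin n)) :
    Continuous fun η : EuclideanSpace ℝ (Fin n) =>
      Complex.exp (2 * π * ⟪η, x⟫ * Complex.I) := by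
  fun_prop

theorem norm_cexp_inner (η x : EuclideanSpace ℝ (Fin n)) :
    ‖Complex.exp (2 * π * ⟪η, x⟫ * Complex.I)‖ = 1 := by
  rw [← Complex.ofReal_ofNat, ← Complex.ofReal_mul, ← Complex.ofReal_mul,
    Complex.norm_exp_ofReal_mul_I]

/-- The Gaussian localizations of a Bessel potential, expressed through the Gaussian localizations
of the function. -/
theorem reproConst_mul_multiplier_schwartzBessel (t : ℝ)
    (hI : ∀ ξ ζ : EuclideanSpace ℝ (Fin n), Integrable (localSymbol t ξ ζ))
    (f : SchwartzMap (EuclideanSpace ℝ (Fin n)) ℂ) (x ξ : EuclideanSpace ℝ (Fin n)) :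
    (reproConst n : ℂ) *
        multiplier (fun η => (dualGauss (η - (2 * π)⁻¹ • ξ) : ℂ)) (schwartzBessel t f) x =
      ∫ ζ, ∫ y, 𝓕 (localSymbol t ξ ζ) (y - x) *
        multiplier (fun η => (dualGauss (η - (2 * π)⁻¹ • ζ) : ℂ)) f y := by
  set B := schwartzBessel t f with hB
  set a : EuclideanSpace ℝ (Fin n) → ℂ := fun η =>
    Complex.exp (2 * π * ⟪η, x⟫ * Complex.I) * ((dualGauss (η - (2 * π)⁻¹ • ξ) : ℂ) * 𝓕 B η)
    with ha
  have hac : Continuous a := by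
    have h1 := continuous_cexp_inner x
    have h2 : Continuous fun η : EuclideanSpace ℝ (Fin n) =>
        (dualGauss (η - (2 * π)⁻¹ • ξ) : ℂ) :=
      Complex.continuous_ofReal.comp (continuous_dualGauss.comp (continuous_sub_right _))
    exact h1.mul (h2.mul (𝓕 B).continuous)
  have hai : Integrable a := by
    refine (𝓕 B).integrable.norm.mono' hac.aestronglyMeasurable
      (Filter.Eventually.of_forall fun η => ?_)
    rw [ha]
    simp only [norm_mul, norm_cexp_inner, one_mul]
    refine mul_le_of_le_one_left (norm_nonneg _) ?_
    rw [Complex.norm_of_nonneg (dualGauss_pos _).le]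
    exact dualGauss_le_one _
  have hprod : Integrable (Function.uncurry fun η ζ : EuclideanSpace ℝ (Fin n) =>
      ((dualGauss (η - (2 * π)⁻¹ • ζ) ^ 2 : ℝ) : ℂ) * a η) := by
    have hc : Continuous (Function.uncurry fun η ζ : EuclideanSpace ℝ (Fin n) =>
        ((dualGauss (η - (2 * π)⁻¹ • ζ) ^ 2 : ℝ) : ℂ) * a η) := by
      refine Continuous.mul (Complex.continuous_ofReal.comp ((continuous_dualGauss.comp ?_).pow 2))
        (hac.comp continuous_fst)
      exact continuous_fst.sub ((continuous_const_smul _).comp continuous_snd)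
    refine (integrable_prod_iff hc.aestronglyMeasurable).2
      ⟨Filter.Eventually.of_forall fun η => ?_, ?_⟩
    · have h := (integrable_dualGauss_sub_smul_sq η).ofReal (𝕜 := ℂ)
      exact h.mul_const (a η)
    · have e : (fun η => ∫ ζ : EuclideanSpace ℝ (Fin n), ‖Function.uncurry (fun η ζ =>
          ((dualGauss (η - (2 * π)⁻¹ • ζ) ^ 2 : ℝ) : ℂ) * a η) (η, ζ)‖) =
          fun η => reproConst n * ‖a η‖ := by
        ext η
        simp only [Function.uncurry_apply_pair, norm_mul,
          Complex.norm_of_nonneg (sq_nonneg (dualGauss _)), integral_mul_const,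
          integral_dualGauss_sub_smul_sq]
      rw [e]
      exact hai.norm.const_mul _
  rw [multiplier_apply (hasTemperateGrowth_dualGauss ξ), ← integral_const_mul]
  calc ∫ η, (reproConst n : ℂ) * a η
      = ∫ η, ∫ ζ, ((dualGauss (η - (2 * π)⁻¹ • ζ) ^ 2 : ℝ) : ℂ) * a η := by
        simp only [integral_mul_const, integral_complex_ofReal, integral_dualGauss_sub_smul_sq]
    _ = ∫ ζ, ∫ η, ((dualGauss (η - (2 * π)⁻¹ • ζ) ^ 2 : ℝ) : ℂ) * a η :=
        integral_integral_swap hprod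
    _ = _ := by
        refine integral_congr_ae (Filter.Eventually.of_forall fun ζ => ?_)
        set h := multiplier (fun η => (dualGauss (η - (2 * π)⁻¹ • ζ) : ℂ)) f with hh
        have hb : Integrable fun η : EuclideanSpace ℝ (Fin n) =>
            Complex.exp (2 * π * ⟪η, x⟫ * Complex.I) * localSymbol t ξ ζ η :=
          (hI ξ ζ).bdd_mul (c := 1) (continuous_cexp_inner x).aestronglyMeasurable
            (Filter.Eventually.of_forall fun η => (norm_cexp_inner η x).le)
        have key := integral_fourier_mul_eq_of_integrable hb h.integrable
        simp only [fourier_modulation] at key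
        simp only
        rw [key]
        refine integral_congr_ae (Filter.Eventually.of_forall fun η => ?_)
        simp only
        rw [← fourier_coe, hh, fourier_multiplier_apply (hasTemperateGrowth_dualGauss ζ), ha, hB,
          localSymbol, schwartzBessel]
        simp only [fourier_multiplier_apply (hasTemperateGrowth_jp t)]
        push_cast
        ring

theorem enorm_multiplier_dualGauss_apply (f : SchwartzMap (EuclideanSpace ℝ (Fin n)) ℂ)
    (x ξ : EuclideanSpace ℝ (Fin n)) :
    ‖multiplier (fun η => (dualGauss (η - (2 * π)⁻¹ • ξ) : ℂ)) f x‖ₑ =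
      ‖gaussConst n‖ₑ * ‖STFT gauss f x ξ‖ₑ := by
  have : ‖Complex.exp (Complex.I * (⟪ξ, x⟫ : ℝ))‖ₑ = 1 := by
    rw [mul_comm, ← ofReal_norm, Complex.norm_exp_ofReal_mul_I, ENNReal.ofReal_one]
  rw [multiplier_dualGauss_apply, enorm_mul, enorm_mul, this, mul_one]

theorem exists_enorm_STFT_schwartzBessel_le (t : ℝ) {K : ℝ} (hK : 0 ≤ K) :
    ∃ C, 0 ≤ C ∧ ∀ (f : SchwartzMap (EuclideanSpace ℝ (Fin n)) ℂ)
      (x ξ : EuclideanSpace ℝ (Fin n)), ‖STFT gauss (schwartzBessel t f) x ξ‖ₑ ≤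
        ∫⁻ ζ, ∫⁻ y, ENNReal.ofReal (C * (jp t ξ * jp (-K) (ξ - ζ) * jp (-(n + 1)) (y - x))) *
          ‖STFT gauss f y ζ‖ₑ := by
  obtain ⟨hI, C, hC0, hC⟩ := integrable_localSymbol_and_norm_fourier_le (n := n) t hK
  have hr := reproConst_pos n
  refine ⟨(reproConst n)⁻¹ * C, by positivity, fun f x ξ => ?_⟩
  have h := congrArg enorm (reproConst_mul_multiplier_schwartzBessel t hI f x ξ)
  rw [enorm_mul, enorm_multiplier_dualGauss_apply] at h
  have hc0 : ‖gaussConst n‖ₑ ≠ 0 := enorm_ne_zero.2 (gaussConst_ne_zero n)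
  have hc : ‖(reproConst n : ℂ)‖ₑ = ENNReal.ofReal (reproConst n) := by
    rw [← ofReal_norm, Complex.norm_of_nonneg hr.le]
  have h2 : ‖gaussConst n‖ₑ * (ENNReal.ofReal (reproConst n) *
      ‖STFT gauss (schwartzBessel t f) x ξ‖ₑ) ≤ ‖gaussConst n‖ₑ *
      ∫⁻ ζ, ∫⁻ y, ENNReal.ofReal (C * (jp t ξ * jp (-K) (ξ - ζ) * jp (-(n + 1)) (y - x))) *
          ‖STFT gauss f y ζ‖ₑ := by
    rw [mul_left_comm, ← hc, h, ← lintegral_const_mul' _ _ enorm_ne_top]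
    simp_rw [← lintegral_const_mul' _ _ (enorm_ne_top (x := gaussConst n))]
    refine (enorm_integral_le_lintegral_enorm _).trans (lintegral_mono fun ζ => ?_)
    refine (enorm_integral_le_lintegral_enorm _).trans (lintegral_mono fun y => ?_)
    rw [enorm_mul, enorm_multiplier_dualGauss_apply, mul_left_comm]
    gcongr
    rw [← ofReal_norm]
    exact ENNReal.ofReal_le_ofReal (hC ξ ζ (y - x))
  have h3 := (ENNReal.mul_le_mul_iff_right hc0 enorm_ne_top).1 h2
  have hr0 : ENNReal.ofReal (reproConst n) ≠ 0 := by simpa using hr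
  calc ‖STFT gauss (schwartzBessel t f) x ξ‖ₑ
      = ENNReal.ofReal (reproConst n)⁻¹ * (ENNReal.ofReal (reproConst n) *
        ‖STFT gauss (schwartzBessel t f) x ξ‖ₑ) := by
        rw [← mul_assoc, ← ENNReal.ofReal_mul (by positivity), inv_mul_cancel₀ hr.ne',
          ENNReal.ofReal_one, one_mul]
    _ ≤ _ := by
        refine (mul_le_mul_right h3 _).trans_eq ?_
        rw [← lintegral_const_mul' _ _ ENNReal.ofReal_ne_top]
        simp_rw [← lintegral_const_mul' _ _ (ENNReal.ofReal_ne_top (r := (reproConst n)⁻¹)),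
          ← mul_assoc, ← ENNReal.ofReal_mul (inv_nonneg.2 hr.le), ← mul_assoc]

end Reproducing

section Lifting

variable {n : ℕ}

theorem lpN_eq_eLpNorm {p : ℝ≥0∞} (hp : 1 ≤ p) (F : EuclideanSpace ℝ (Fin n) → ℝ≥0∞) :
    lpN p F = eLpNorm F p volume := by
  have hp0 : p ≠ 0 := (zero_lt_one.trans_le hp).ne'
  unfold lpN
  split_ifs with h
  · rw [h, eLpNorm_exponent_top]
    rfl
  · rw [eLpNorm_eq_lintegral_rpow_enorm_toReal hp0 h, one_div]
    simp only [enorm_eq_self]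

theorem measurable_STFT_gauss (f : SchwartzMap (EuclideanSpace ℝ (Fin n)) ℂ) :
    Measurable (Function.uncurry (STFT gauss f)) := by
  have hg : Continuous (gauss : EuclideanSpace ℝ (Fin n) → ℂ) := by
    unfold gauss
    fun_prop
  have hc : Continuous fun z :
      (EuclideanSpace ℝ (Fin n) × EuclideanSpace ℝ (Fin n)) × EuclideanSpace ℝ (Fin n) =>
      Complex.exp (-(Complex.I * Complex.ofReal ⟪z.1.2, z.2⟫)) *
        (starRingEnd ℂ) (gauss (z.2 - z.1.1)) * f z.2 := by
    refine Continuous.mul (Continuous.mul ?_ ?_) (f.continuous.comp continuous_snd)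
    · fun_prop
    · exact Complex.continuous_conj.comp (hg.comp (by fun_prop))
  exact (hc.stronglyMeasurable.integral_prod_right (ν := volume)).measurable

theorem eLpNorm_eLpNorm_le_of_le_lintegral_translate
    {μ₁ μ₂ : Measure (EuclideanSpace ℝ (Fin n))} [IsFiniteMeasure μ₁] [IsFiniteMeasure μ₂]
    {p q : ℝ≥0∞} (hp : 1 ≤ p) (hq : 1 ≤ q)
    {F G : EuclideanSpace ℝ (Fin n) → EuclideanSpace ℝ (Fin n) → ℝ≥0∞}
    (hG : Measurable (Function.uncurry G))
    (hF : ∀ x ξ, F x ξ ≤ ∫⁻ z, ∫⁻ w, G (w + x) (z + ξ) ∂μ₂ ∂μ₁) :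
    eLpNorm (fun x => eLpNorm (F x) q volume) p volume ≤
      eLpNorm (fun x => eLpNorm (G x) q volume) p volume * μ₂ Set.univ * μ₁ Set.univ := by
  set H := fun x => eLpNorm (G x) q volume with hH
  have hHm : Measurable H := measurable_eLpNorm_right (zero_lt_one.trans_le hq).ne' hG
  have h1 : ∀ x, eLpNorm (F x) q volume ≤ ∫⁻ _, ∫⁻ w, H (w + x) ∂μ₂ ∂μ₁ := by
    intro x
    have hm1 : Measurable (Function.uncurry fun z ξ => ∫⁻ w, G (w + x) (z + ξ) ∂μ₂) := by
      refine Measurable.lintegral_prod_right' (f := fun u :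
        (EuclideanSpace ℝ (Fin n) × EuclideanSpace ℝ (Fin n)) × EuclideanSpace ℝ (Fin n) =>
        G (u.2 + x) (u.1.1 + u.1.2)) ?_
      exact hG.comp (by fun_prop : Measurable fun u :
        (EuclideanSpace ℝ (Fin n) × EuclideanSpace ℝ (Fin n)) × EuclideanSpace ℝ (Fin n) =>
        (u.2 + x, u.1.1 + u.1.2))
    refine (eLpNorm_mono_enorm (hF x)).trans ((eLpNorm_lintegral_le hq hm1).trans ?_)
    refine lintegral_mono fun z => ?_
    have hm2 : Measurable (Function.uncurry fun w ξ => G (w + x) (z + ξ)) :=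
      hG.comp (by fun_prop : Measurable fun u :
        EuclideanSpace ℝ (Fin n) × EuclideanSpace ℝ (Fin n) => (u.1 + x, z + u.2))
    refine (eLpNorm_lintegral_le hq hm2).trans (lintegral_mono fun w => ?_)
    exact (eLpNorm_comp_measurePreserving (g := G (w + x))
      (hG.comp measurable_prodMk_left).aestronglyMeasurable
      (measurePreserving_add_left volume z)).le
  have hm3 : Measurable (Function.uncurry fun w x => H (w + x)) :=
    hHm.comp (by fun_prop : Measurable fun u :
      EuclideanSpace ℝ (Fin n) × EuclideanSpace ℝ (Fin n) => u.1 + u.2)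
  have hm4 : Measurable (Function.uncurry fun (_ : EuclideanSpace ℝ (Fin n)) x =>
      ∫⁻ w, H (w + x) ∂μ₂) := by
    refine Measurable.comp (g := fun x => ∫⁻ w, H (w + x) ∂μ₂) ?_ measurable_snd
    exact Measurable.lintegral_prod_left' (f := fun u :
      EuclideanSpace ℝ (Fin n) × EuclideanSpace ℝ (Fin n) => H (u.1 + u.2)) hm3
  refine (eLpNorm_mono_enorm h1).trans ((eLpNorm_lintegral_le hp hm4).trans ?_)
  rw [lintegral_const]
  gcongr
  refine (eLpNorm_lintegral_le hp hm3).trans_eq ?_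
  rw [← lintegral_const]
  refine lintegral_congr fun w => ?_
  exact eLpNorm_comp_measurePreserving (g := H) hHm.aestronglyMeasurable
    (measurePreserving_add_left volume w)

/-- The measure with density `c ⟨x⟩^{-(n+1)}`. -/
def jpMeasure (n : ℕ) (c : ℝ) : Measure (EuclideanSpace ℝ (Fin n)) :=
  volume.withDensity fun x => ENNReal.ofReal (c * jp (-(n + 1)) x)

instance isFiniteMeasure_jpMeasure (n : ℕ) (c : ℝ) : IsFiniteMeasure (jpMeasure n c) := by
  refine isFiniteMeasure_withDensity_ofReal ?_
  exact ((integrable_jp (by linarith)).const_mul c).hasFiniteIntegral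

theorem lintegral_jpMeasure (c : ℝ) {g : EuclideanSpace ℝ (Fin n) → ℝ≥0∞} (hg : Measurable g) :
    ∫⁻ x, g x ∂(jpMeasure n c) = ∫⁻ x, ENNReal.ofReal (c * jp (-(n + 1)) x) * g x :=
  lintegral_withDensity_eq_lintegral_mul _
    ((continuous_jp _).const_mul c).measurable.ennreal_ofReal hg

theorem lintegral_lintegral_jpMeasure (c c' : ℝ)
    {G : EuclideanSpace ℝ (Fin n) → EuclideanSpace ℝ (Fin n) → ℝ≥0∞}
    (hG : Measurable (Function.uncurry G)) (x ξ : EuclideanSpace ℝ (Fin n)) :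
    ∫⁻ z, ∫⁻ w, G (w + x) (z + ξ) ∂(jpMeasure n c') ∂(jpMeasure n c) =
      ∫⁻ z, ENNReal.ofReal (c * jp (-(n + 1)) z) *
        ∫⁻ w, ENNReal.ofReal (c' * jp (-(n + 1)) w) * G (w + x) (z + ξ) := by
  have hm : Measurable fun z => ∫⁻ w, G (w + x) (z + ξ) ∂(jpMeasure n c') := by
    refine Measurable.lintegral_prod_right' (f := fun u :
      EuclideanSpace ℝ (Fin n) × EuclideanSpace ℝ (Fin n) => G (u.2 + x) (u.1 + ξ)) ?_
    exact hG.comp (by fun_prop : Measurable fun u :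
      EuclideanSpace ℝ (Fin n) × EuclideanSpace ℝ (Fin n) => (u.2 + x, u.1 + ξ))
  have hm' : ∀ z, Measurable fun w => G (w + x) (z + ξ) := fun z =>
    hG.comp (by fun_prop : Measurable fun w : EuclideanSpace ℝ (Fin n) => (w + x, z + ξ))
  rw [lintegral_jpMeasure c hm]
  simp_rw [lintegral_jpMeasure c' (hm' _)]

theorem WNorm_eq_eLpNorm (s : ℝ) {p q : ℝ≥0∞} (hp : 1 ≤ p) (hq : 1 ≤ q)
    (f : EuclideanSpace ℝ (Fin n) → ℂ) :
    WNorm s p q f = eLpNorm (fun x => eLpNorm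
      (fun ξ => ENNReal.ofReal (jp s ξ) * ‖STFT gauss f x ξ‖ₑ) q volume) p volume := by
  unfold WNorm
  simp only [lpN_eq_eLpNorm hp, lpN_eq_eLpNorm hq]
  rfl

theorem exists_WNorm_schwartzBessel_le (s t : ℝ) {p q : ℝ≥0∞} (hp : 1 ≤ p) (hq : 1 ≤ q) :
    ∃ C : ℝ, 1 ≤ C ∧ ∀ f : SchwartzMap (EuclideanSpace ℝ (Fin n)) ℂ,
      WNorm (s - t) p q (schwartzBessel t f) ≤ ENNReal.ofReal C * WNorm s p q f := by
  have hn0 : (0 : ℝ) ≤ n := n.cast_nonneg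
  have hs0 := abs_nonneg s
  obtain ⟨C, hC0, hC⟩ := exists_enorm_STFT_schwartzBessel_le (n := n) t
    (K := |s| + (n + 1)) (by positivity)
  set c := 2 ^ (|s| / 2) * C with hc
  set D := jpMeasure n 1 Set.univ * jpMeasure n c Set.univ with hD
  have hDtop : D ≠ ∞ := ENNReal.mul_ne_top (measure_ne_top _ _) (measure_ne_top _ _)
  refine ⟨max 1 D.toReal, le_max_left _ _, fun f => ?_⟩
  set G : EuclideanSpace ℝ (Fin n) → EuclideanSpace ℝ (Fin n) → ℝ≥0∞ :=
    fun y ζ => ENNReal.ofReal (jp s ζ) * ‖STFT gauss f y ζ‖ₑ with hG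
  have hGm : Measurable (Function.uncurry G) :=
    ((continuous_jp s).measurable.ennreal_ofReal.comp measurable_snd).mul
      (measurable_STFT_gauss f).enorm
  have key : ∀ x ξ, ENNReal.ofReal (jp (s - t) ξ) * ‖STFT gauss (schwartzBessel t f) x ξ‖ₑ ≤
      ∫⁻ z, ∫⁻ w, G (w + x) (z + ξ) ∂(jpMeasure n 1) ∂(jpMeasure n c) := by
    intro x ξ
    rw [lintegral_lintegral_jpMeasure c 1 hGm x ξ]
    refine (mul_le_mul_right (hC f x ξ) _).trans ?_
    rw [← lintegral_add_right_eq_self _ ξ, ← lintegral_const_mul' _ _ ENNReal.ofReal_ne_top]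
    refine lintegral_mono fun z => ?_
    rw [← lintegral_add_right_eq_self _ x, ← lintegral_const_mul' _ _ ENNReal.ofReal_ne_top,
      ← lintegral_const_mul' _ _ ENNReal.ofReal_ne_top]
    refine lintegral_mono fun w => ?_
    simp only [hG, add_sub_cancel_right, ← mul_assoc]
    rw [jp_sub_comm _ ξ, add_sub_cancel_right, one_mul]
    have p1 := jp_pos (s - t) ξ
    have p2 := jp_pos (-(n + 1)) z
    have p3 := jp_pos (-(n + 1)) w
    have p4 := jp_pos (-(|s| + (n + 1))) z
    have hc0 : 0 ≤ c := by positivity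
    rw [← ENNReal.ofReal_mul p1.le, ← ENNReal.ofReal_mul (by positivity),
      ← ENNReal.ofReal_mul (by positivity)]
    refine mul_le_mul_left (ENNReal.ofReal_le_ofReal ?_) _
    have h := jp_le_peetre s ξ (z + ξ)
    rw [jp_sub_comm, add_sub_cancel_right] at h
    calc jp (s - t) ξ * (C * jp t ξ * jp (-(|s| + (n + 1))) z * jp (-(n + 1)) w)
        = C * (jp (s - t) ξ * jp t ξ) * jp (-(|s| + (n + 1))) z * jp (-(n + 1)) w := by ring
      _ = C * jp s ξ * jp (-(|s| + (n + 1))) z * jp (-(n + 1)) w := by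
          rw [jp_mul_jp, sub_add_cancel]
      _ ≤ C * (2 ^ (|s| / 2) * jp s (z + ξ) * jp |s| z) * jp (-(|s| + (n + 1))) z *
          jp (-(n + 1)) w := by gcongr
      _ = c * (jp |s| z * jp (-(|s| + (n + 1))) z) * jp (-(n + 1)) w * jp s (z + ξ) := by ring
      _ = c * jp (-(n + 1)) z * jp (-(n + 1)) w * jp s (z + ξ) := by
          rw [jp_mul_jp]
          congr 4
          ring
  rw [WNorm_eq_eLpNorm _ hp hq, WNorm_eq_eLpNorm _ hp hq]
  refine (eLpNorm_eLpNorm_le_of_le_lintegral_translate hp hq hGm key).trans ?_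
  rw [mul_assoc, mul_comm]
  gcongr
  exact (ENNReal.ofReal_toReal hDtop).symm.trans_le
    (ENNReal.ofReal_le_ofReal (le_max_right _ _))

end Lifting

/-- Lifting property: `(I - Δ)^{t/2}` maps `W^s_{p,q}` isomorphically onto `W^{s-t}_{p,q}`,
with `‖(I - Δ)^{t/2} f‖_{W^{s-t}_{p,q}} ∼ ‖f‖_{W^s_{p,q}}`. -/
theorem bessel_potential_lifting (n : ℕ) (hn : 1 ≤ n) (s t : ℝ) (p q : ℝ≥0∞)
    (hp : 1 ≤ p) (hq : 1 ≤ q) :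
    ∃ C : ℝ, 1 ≤ C ∧ ∀ f : SchwartzMap (EuclideanSpace ℝ (Fin n)) ℂ,
      ENNReal.ofReal C⁻¹ * WNorm s p q ⇑f ≤ WNorm (s - t) p q (bessel t ⇑f) ∧
      WNorm (s - t) p q (bessel t ⇑f) ≤ ENNReal.ofReal C * WNorm s p q ⇑f := by
  obtain ⟨A, hA1, hA⟩ := exists_WNorm_schwartzBessel_le (n := n) s t hp hq
  obtain ⟨B, hB1, hB⟩ := exists_WNorm_schwartzBessel_le (n := n) (s - t) (-t) hp hq
  have hC : 0 < max A B := zero_lt_one.trans_le (hA1.trans (le_max_left _ _))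
  refine ⟨max A B, hA1.trans (le_max_left _ _), fun f => ?_⟩
  rw [bessel_eq_schwartzBessel]
  constructor
  · have h := hB (schwartzBessel t f)
    rw [schwartzBessel_neg_schwartzBessel, sub_neg_eq_add, sub_add_cancel] at h
    calc ENNReal.ofReal (max A B)⁻¹ * WNorm s p q f
        ≤ ENNReal.ofReal (max A B)⁻¹ *
          (ENNReal.ofReal (max A B) * WNorm (s - t) p q (schwartzBessel t f)) := by
          gcongr
          refine h.trans ?_
          gcongr
          exact le_max_right _ _
      _ = WNorm (s - t) p q (schwartzBessel t f) := by
          rw [← mul_assoc, ← ENNReal.ofReal_mul (by positivity), inv_mul_cancel₀ hC.ne',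
            ENNReal.ofReal_one, one_mul]
  · refine (hA f).trans ?_
    gcongr
    exact le_max_left _ _

end
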